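/- arXiv:math/0106117 — 3 statements merged into one kernel-verified Lean document; each statement's English description precedes it below -/
import Mathlib

section
/- Let E : A → B be a faithful conditional expectation between unital C*-algebras admitting a quasi-basis. Then a quasi-basis of the form {(w_j, w_j*)}_{j=1}^m exists; consequently the Watatani index Ind(E) = Σ_j w_j w_j* is a positive element of A. -/
theorem aux_decomp {R : Type*} [CStarAlgebra R] (M : R) (hM : IsSelfAdjoint M) :
    ∃ P Q : R, IsSelfAdjoint P ∧ IsSelfAdjoint Q ∧ M = P * P - Q * Q ∧ Q * P = 0 := by
  let p : ℝ → ℝ := fun x => Real.sqrt x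
  let q : ℝ → ℝ := fun x => Real.sqrt (-x)
  have hpc : Continuous p := by fun_prop
  have hqc : Continuous q := by fun_prop
  have hpq : ∀ x, x = p x * p x - q x * q x := by
    intro x
    rcases le_total 0 x with h | h
    · simp [p, q, Real.mul_self_sqrt h, Real.sqrt_eq_zero_of_nonpos (neg_nonpos.2 h)]
    · simp [p, q, Real.mul_self_sqrt (neg_nonneg.2 h), Real.sqrt_eq_zero_of_nonpos h]
  have hpq0 : ∀ x, q x * p x = 0 := by
    intro x
    rcases le_total 0 x with h | h
    · simp [p, q, Real.sqrt_eq_zero_of_nonpos (neg_nonpos.2 h)]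
    · simp [p, q, Real.sqrt_eq_zero_of_nonpos h]
  let P := cfc p M
  let Q := cfc q M
  have hP : IsSelfAdjoint P := cfc_predicate p M
  have hQ : IsSelfAdjoint Q := cfc_predicate q M
  have hMP : M = P * P - Q * Q := by
    have h1 : P * P = cfc (fun x => p x * p x) M := (cfc_mul p p M).symm
    have h2 : Q * Q = cfc (fun x => q x * q x) M := (cfc_mul q q M).symm
    rw [h1, h2, ← cfc_sub (fun x => p x * p x) (fun x => q x * q x) M, ← cfc_congr (fun x _ => hpq x)]
    exact (cfc_id' ℝ M).symm
  have hQP : Q * P = 0 := by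
    have h1 : Q * P = cfc (fun x => q x * p x) M := (cfc_mul q p M).symm
    rw [h1, cfc_congr (g := fun _ => (0 : ℝ)) (fun x _ => hpq0 x)]
    exact cfc_const_zero ℝ M
  exact ⟨P, Q, hP, hQ, hMP, hQP⟩

theorem aux_sqrt {A C : Type*} [CStarAlgebra C] [CStarAlgebra A] [PartialOrder A]
    [StarOrderedRing A] (φ : C →⋆ₐ[ℂ] A) (hφ : Function.Injective φ) {n : ℕ}
    (D : Fin n → Fin n → C) (hsa : ∀ i j, star (D i j) = D j i)
    (hp : ∀ b : Fin n → C, 0 ≤ φ (∑ i, ∑ j, star (b i) * D i j * b j)) :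
    ∃ c : Fin n → Fin n → C, ∀ i k, ∑ j, c i j * star (c k j) = D i k := by
  let : PartialOrder C := CStarAlgebra.spectralOrder C
  have : StarOrderedRing C := CStarAlgebra.spectralOrderedRing C
  let M : CStarMatrix (Fin n) (Fin n) C := CStarMatrix.ofMatrix D
  have hM : IsSelfAdjoint M := by
    ext i j
    rw [CStarMatrix.star_apply]
    exact hsa j i
  obtain ⟨P, Q, hP, hQ, hMP, hQP⟩ := aux_decomp M hM
  let X := Q * Q * Q
  have hX : star X = X := by
    simp [X, hQ.star_eq, mul_assoc]
  have hkey : star (Q * Q) * (M * (Q * Q)) = -(star X * X) := by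
    rw [hX, hMP]
    simp only [star_mul, hQ.star_eq, X]
    have : Q * Q * ((P * P - Q * Q) * (Q * Q)) = Q * (Q * P) * P * Q * Q - Q*Q*Q*(Q*Q*Q) := by
      noncomm_ring
    rw [this, hQP]; simp
  have hX0 : X = 0 := by
    ext l k
    have h1 := hp (fun i => (Q * Q) i k)
    have h2 : ∑ i, ∑ j, star ((Q * Q) i k) * D i j * (Q * Q) j k
        = -∑ i, star (X i k) * X i k := by
      have := congrArg (fun Y : CStarMatrix (Fin n) (Fin n) C => Y k k) hkey
      simp only [CStarMatrix.neg_apply, CStarMatrix.mul_apply (M := star X)] at this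
      rw [CStarMatrix.mul_apply (M := star (Q*Q))] at this
      simp only [CStarMatrix.mul_apply (M := M), CStarMatrix.star_apply, Finset.mul_sum] at this
      rw [← this]
      simp only [mul_assoc]
      rfl
    rw [h2] at h1
    have h3 : ∑ i, star (φ (X i k)) * φ (X i k) = 0 := by
      refine le_antisymm ?_ (Finset.sum_nonneg fun i _ => star_mul_self_nonneg _)
      simpa [map_sum, map_star] using h1
    have h4 := (Finset.sum_eq_zero_iff_of_nonneg
      (fun i _ => star_mul_self_nonneg (φ (X i k)))).1 h3 l (Finset.mem_univ _)
    rw [CStarRing.star_mul_self_eq_zero_iff] at h4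
    exact hφ (by simpa using h4)
  have hQQ : Q * Q = 0 := by
    rw [← CStarRing.star_mul_self_eq_zero_iff]
    rw [star_mul, hQ.star_eq, ← mul_assoc]
    change X * Q = 0
    rw [hX0, zero_mul]
  have hfin : M = P * P := by rw [hMP, hQQ, sub_zero, ]
  refine ⟨fun i j => P i j, fun i k => ?_⟩
  have h5 : (P * star P) i k = M i k := by rw [hP.star_eq, ← hfin]
  rw [CStarMatrix.mul_apply] at h5
  simp only [CStarMatrix.star_apply] at h5
  exact h5

theorem aux_main {A : Type*} [CStarAlgebra A] [PartialOrder A] [StarOrderedRing A]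
    (B : StarSubalgebra ℂ A)
    (E : A →ₗ[ℂ] A)
    (hrange : ∀ x : A, E x ∈ B)
    (hfix : ∀ b ∈ B, E b = b)
    (hleft : ∀ b ∈ B, ∀ x : A, E (b * x) = b * E x)
    (hright : ∀ b ∈ B, ∀ x : A, E (x * b) = E x * b)
    (hpos : ∀ x : A, 0 ≤ x → 0 ≤ E x)
    (hstar : ∀ x : A, E (star x) = star (E x))
    {n : ℕ} (u v : Fin n → A)
    (hqb1 : ∀ a : A, a = ∑ i, u i * E (v i * a))
    (hqb2 : ∀ a : A, a = ∑ i, E (a * u i) * v i) :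
    ∃ (m : ℕ) (w : Fin m → A),
      (∀ a : A, a = ∑ j, w j * E (star (w j) * a)) ∧
      (∀ a : A, a = ∑ j, E (a * w j) * star (w j)) ∧
      0 ≤ ∑ j, w j * star (w j) ∧
      (∑ j, w j * star (w j)) = ∑ i, u i * v i := by
  have hcont : Continuous E := map_continuous (PositiveLinearMap.mk₀ E hpos)
  have hB : (B : Set A) = {x | E x = x} := by
    ext x
    exact ⟨fun h => hfix x h, fun h => by
      have := hrange x
      have h' : E x = x := h
      rw [h'] at this
      exact this⟩
  have hcl : IsClosed (B : Set A) := by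
    rw [hB]
    exact isClosed_eq hcont continuous_id
  let : CStarAlgebra B := StarSubalgebra.cstarAlgebra B
  obtain ⟨c, hc⟩ := aux_sqrt (A := A) (C := B) B.subtype Subtype.val_injective
    (fun i k : Fin n => (⟨E (v i * star (v k)), hrange _⟩ : B))
    (by
      intro i j
      apply Subtype.ext
      change star (E (v i * star (v j))) = E (v j * star (v i))
      rw [← hstar]; simp)
    (by
      intro b
      have h0 := hpos _ (mul_star_self_nonneg (∑ i, star (b i : A) * v i))
      convert h0 using 1
      simp only [star_sum, Finset.sum_mul_sum, map_sum, star_mul, star_star]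
      refine Finset.sum_congr rfl fun i _ => Finset.sum_congr rfl fun j _ => ?_
      rw [show star (b i : A) * v i * (star (v j) * (b j : A))
        = star (b i : A) * ((v i * star (v j)) * (b j : A)) by simp only [mul_assoc],
        hleft _ (star_mem (b i).2), hright _ (b j).2, ← mul_assoc]
      rfl)
  have hc' : ∀ i k, ∑ j, (c i j : A) * star (c k j : A) = E (v i * star (v k)) := by
    intro i k
    have := congrArg (Subtype.val) (hc i k)
    simpa using this
  -- adjoint quasi-basis identities
  have hq1 : ∀ a : A, a = ∑ k, E (a * star (v k)) * star (u k) := by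
    intro a
    have := congrArg star (hqb1 (star a))
    simpa [star_sum, ← hstar] using this
  have hq2 : ∀ a : A, a = ∑ k, star (v k) * E (star (u k) * a) := by
    intro a
    have := congrArg star (hqb2 (star a))
    simpa [star_sum, ← hstar] using this
  let w : Fin n → A := fun j => ∑ i, u i * (c i j : A)
  have hw1 : ∀ a : A, a = ∑ j, w j * E (star (w j) * a) := by
    intro a
    have h1 : ∀ j, w j * E (star (w j) * a)
        = ∑ i, ∑ k, u i * ((c i j : A) * star (c k j : A)) * E (star (u k) * a) := by
      intro j
      have : E (star (w j) * a) = ∑ k, star (c k j : A) * E (star (u k) * a) := by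
        simp only [w, star_sum, star_mul, Finset.sum_mul, map_sum, mul_assoc]
        exact Finset.sum_congr rfl fun k _ => hleft _ (star_mem (c k j).2) _
      rw [this]
      simp only [w, Finset.sum_mul_sum, mul_assoc]
    simp only [h1]
    rw [Finset.sum_comm]
    conv_lhs => rw [hqb1 a]
    refine Finset.sum_congr rfl fun i _ => ?_
    rw [Finset.sum_comm]
    simp only [← Finset.sum_mul, ← Finset.mul_sum, hc']
    simp only [mul_assoc, ← Finset.mul_sum]
    congr 1
    conv_lhs => rw [hq2 a]
    simp only [Finset.mul_sum, map_sum]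
    refine Finset.sum_congr rfl fun k _ => ?_
    rw [← mul_assoc, hright _ (hrange _)]
  refine ⟨n, w, hw1, ?_, Finset.sum_nonneg fun j _ => mul_star_self_nonneg _, ?_⟩
  · intro a
    have := congrArg star (hw1 (star a))
    simpa [star_sum, ← hstar] using this
  · have h1 : ∀ j, w j * star (w j)
        = ∑ i, ∑ k, u i * ((c i j : A) * star (c k j : A)) * star (u k) := by
      intro j
      simp only [w, star_sum, star_mul, Finset.sum_mul_sum, mul_assoc]
    simp only [h1]
    rw [Finset.sum_comm]
    refine Finset.sum_congr rfl fun i _ => ?_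
    rw [Finset.sum_comm]
    simp only [← Finset.sum_mul, ← Finset.mul_sum, hc']
    simp only [mul_assoc, ← Finset.mul_sum]
    rw [← hq1]


/-- Let `E : A → B` be a faithful conditional expectation
between unital C*-algebras admitting a quasi-basis.  Then a quasi-basis of the
form `{(w j, (w j)⋆)}` exists; consequently the Watatani index
`Ind E = ∑ w j * (w j)⋆` is a positive element of `A`. -/
theorem stmt_6 {A : Type*} [NormedRing A] [StarRing A] [CStarRing A] [NormedAlgebra ℂ A]
    [StarModule ℂ A] [CompleteSpace A] [PartialOrder A] [StarOrderedRing A]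
    (B : StarSubalgebra ℂ A)
    (E : A →ₗ[ℂ] A)
    (hrange : ∀ x : A, E x ∈ B)
    (hfix : ∀ b ∈ B, E b = b)
    (hleft : ∀ b ∈ B, ∀ x : A, E (b * x) = b * E x)
    (hright : ∀ b ∈ B, ∀ x : A, E (x * b) = E x * b)
    (hpos : ∀ x : A, 0 ≤ x → 0 ≤ E x)
    (hstar : ∀ x : A, E (star x) = star (E x))
    (hfaith : ∀ x : A, 0 ≤ x → E x = 0 → x = 0)
    {n : ℕ} (u v : Fin n → A)
    (hqb1 : ∀ a : A, a = ∑ i, u i * E (v i * a))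
    (hqb2 : ∀ a : A, a = ∑ i, E (a * u i) * v i) :
    ∃ (m : ℕ) (w : Fin m → A),
      (∀ a : A, a = ∑ j, w j * E (star (w j) * a)) ∧
      (∀ a : A, a = ∑ j, E (a * w j) * star (w j)) ∧
      0 ≤ ∑ j, w j * star (w j) ∧
      (∑ j, w j * star (w j)) = ∑ i, u i * v i := by
  let : CStarAlgebra A := {}
  exact aux_main B E hrange hfix hleft hright hpos hstar u v hqb1 hqb2
end

section
/- Let A ⊃ B be an inclusion of unital C*-algebras with a conditional expectation E : A → B satisfying the Pimsner–Popa inequality x ≤ λE(x) for x ∈ A₊. If B is simple, then every closed two-sided ideal J of A is generated by a projection z in the center of A: the approximate unit of J converges in norm to a central projection z with J = Az. -/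
section aux
variable {A : Type*} [CStarAlgebra A] [PartialOrder A] [StarOrderedRing A]

theorem aux_simple (B : StarSubalgebra ℂ A) (hB : IsClosed (B : Set A))
    (hBsimple : ∀ I : TwoSidedIdeal B, IsClosed (I : Set B) → I = ⊥ ∨ I = ⊤)
    (G : Set A) (G0 : (0 : A) ∈ G) (Gadd : ∀ x ∈ G, ∀ y ∈ G, x + y ∈ G)
    (Gconj : ∀ k ∈ G, ∀ c ∈ B, star c * k * c ∈ G)
    (h : A) (hhB : h ∈ B) (hsa : star h = h) (h0 : h ≠ 0) (hG : h * h ∈ G) :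
    ∃ k ∈ G, (1 : A) + 1 ≤ k := by
  let S : Set B := {y | ∀ c d : B, ∃ k ∈ G,
    (c : A) * y * d + star ((c : A) * y * d) ≤ k}
  have S0 : (0 : B) ∈ S := fun c d => ⟨0, G0, by simp⟩
  have Sadd : ∀ x ∈ S, ∀ y ∈ S, x + y ∈ S := by
    intro x hx y hy c d
    obtain ⟨k, hk, h1⟩ := hx c d
    obtain ⟨k', hk', h2⟩ := hy c d
    refine ⟨k + k', Gadd _ hk _ hk', ?_⟩
    refine le_trans (le_of_eq ?_) (add_le_add h1 h2)
    push_cast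
    simp only [mul_add, add_mul, star_add]
    abel
  have Sneg : ∀ x ∈ S, -x ∈ S := by
    intro x hx c d
    obtain ⟨k, hk, h1⟩ := hx (-c) d
    refine ⟨k, hk, le_trans (le_of_eq ?_) h1⟩
    push_cast
    simp
  have Sl : ∀ b, ∀ x ∈ S, b * x ∈ S := by
    intro b x hx c d
    obtain ⟨k, hk, h1⟩ := hx (c * b) d
    refine ⟨k, hk, le_trans (le_of_eq ?_) h1⟩
    push_cast
    simp only [mul_assoc]
  have Sr : ∀ b, ∀ x ∈ S, x * b ∈ S := by
    intro b x hx c d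
    obtain ⟨k, hk, h1⟩ := hx c (b * d)
    refine ⟨k, hk, le_trans (le_of_eq ?_) h1⟩
    push_cast
    simp only [mul_assoc]
  let H : B := ⟨h, hhB⟩
  have HS : H * H ∈ S := by
    intro c d
    refine ⟨star (star (c : A)) * (h * h) * star (c : A) + star (d : A) * (h * h) * d,
      Gadd _ (Gconj _ hG _ (star_mem c.2)) _ (Gconj _ hG _ d.2), ?_⟩
    rw [← sub_nonneg]
    have := star_mul_self_nonneg (h * star (c : A) - h * d)
    refine this.trans (le_of_eq ?_)
    simp only [star_sub, star_mul, star_star, hsa, H]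
    push_cast
    simp only [star_mul, hsa]
    noncomm_ring
  let I : TwoSidedIdeal B := TwoSidedIdeal.mk' (closure S) (subset_closure S0)
    (fun {x y} hx hy => map_mem_closure₂ continuous_add hx hy Sadd)
    (fun {x} hx => map_mem_closure continuous_neg hx Sneg)
    (fun {x y} hy => map_mem_closure (continuous_const_mul x) hy (Sl x))
    (fun {x y} hx => map_mem_closure (f := (· * y)) (continuous_mul_const y) hx (Sr y))
  have hI : (I : Set B) = closure S := TwoSidedIdeal.coe_mk' _ _ _ _ _ _
  have h1 : (1 : B) ∈ closure S := by
    rw [← hI]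
    rcases hBsimple I (hI ▸ isClosed_closure) with hb | hb
    · exfalso
      have : H * H ∈ (I : Set B) := hI ▸ subset_closure HS
      rw [hb] at this
      have h2 : H * H = 0 := by simpa using this
      have h3 : h * h = 0 := congrArg Subtype.val h2
      apply h0
      have : star h * h = 0 := by rwa [hsa]
      exact (CStarRing.star_mul_self_eq_zero_iff h).1 this
    · rw [hb]; trivial
  haveI : CompleteSpace B := hB.completeSpace_coe
  obtain ⟨y, hy, hd⟩ := Metric.mem_closure_iff.1 h1 1 one_pos
  rw [dist_eq_norm] at hd
  have hu : IsUnit y := by simpa using isUnit_one_sub_of_norm_lt_one hd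
  obtain ⟨u, rfl⟩ := hu
  have : (1 : B) ∈ S := by simpa using Sr (↑u⁻¹) _ hy
  simpa using this 1 1

theorem aux_invsqrt (B : StarSubalgebra ℂ A) (hB : IsClosed (B : Set A)) (k : A) (hk : k ∈ B)
    (h1 : 1 ≤ k) : ∃ r ∈ B, star r = r ∧ r * k * r = 1 := by
  have hk0 : 0 ≤ k := zero_le_one.trans h1
  have hs : ∀ x ∈ spectrum ℝ k, 1 ≤ x := by
    have : algebraMap ℝ A 1 ≤ k := by simpa using h1
    exact (algebraMap_le_iff_le_spectrum (ha := IsSelfAdjoint.of_nonneg hk0)).1 this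
  have hc : ContinuousOn (fun x : ℝ => (Real.sqrt x)⁻¹) (spectrum ℝ k) := by
    refine ContinuousOn.inv₀ (by fun_prop) ?_
    intro x hx
    have := hs x hx
    positivity
  refine ⟨cfc (fun x : ℝ => (Real.sqrt x)⁻¹) k, cfc_mem (𝕜' := ℂ) (hs := hB) _ hk, ?_, ?_⟩
  · exact (cfc_predicate (fun x : ℝ => (Real.sqrt x)⁻¹) k : IsSelfAdjoint _)
  · have hka : IsSelfAdjoint k := IsSelfAdjoint.of_nonneg hk0
    conv_lhs => enter [1, 2]; rw [← cfc_id ℝ k]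
    rw [← cfc_mul _ _ k hc, ← cfc_mul _ _ k _ hc, ← cfc_one ℝ k]
    · apply cfc_congr
      intro x hx
      have := hs x hx
      have h2 : Real.sqrt x ≠ 0 := by positivity
      simp only [id, Pi.one_apply]
      field_simp
      exact (Real.sq_sqrt (by linarith)).symm
    · exact hc.mul continuousOn_id

theorem aux_lower (B : StarSubalgebra ℂ A) (hB : IsClosed (B : Set A))
    (hBsimple : ∀ I : TwoSidedIdeal B, IsClosed (I : Set B) → I = ⊥ ∨ I = ⊤)
    (E : A →L[ℂ] A)
    (hrange : ∀ x : A, E x ∈ B)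
    (hleft : ∀ b ∈ B, ∀ x : A, E (b * x) = b * E x)
    (hright : ∀ b ∈ B, ∀ x : A, E (x * b) = E x * b)
    (hpos : ∀ x : A, 0 ≤ x → 0 ≤ E x)
    (J : TwoSidedIdeal A) (u : A) (huJ : u ∈ J) (hu0 : 0 ≤ u) (hu1 : u ≤ 1)
    (t : ℝ) (ht : t < ‖E u‖) :
    ∃ v ∈ J, 0 ≤ v ∧ v ≤ 1 ∧ algebraMap ℝ A t ≤ E v := by
  rcases lt_or_ge t 0 with htn | ht0
  · refine ⟨0, J.zero_mem, le_rfl, zero_le_one, ?_⟩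
    have := algebraMap_mono A htn.le
    simpa using this
  have hT : algebraMap ℝ A t ∈ B := by
    rw [IsScalarTower.algebraMap_apply ℝ ℂ A]
    exact B.algebraMap_mem _
  set a : A := E u - algebraMap ℝ A t with ha
  have haB : a ∈ B := sub_mem (hrange u) hT
  have haS : IsSelfAdjoint a :=
    (IsSelfAdjoint.of_nonneg (hpos u hu0)).sub (IsSelfAdjoint.algebraMap A (IsSelfAdjoint.all t))
  have hhB : a⁺ ∈ B := by
    rw [CFC.posPart_def, cfcₙ_eq_cfc]
    exact cfc_mem (𝕜' := ℂ) (hs := hB) _ haB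
  have hh0 : 0 ≤ a⁺ := CFC.posPart_nonneg a
  have hsa : star a⁺ = a⁺ := IsSelfAdjoint.of_nonneg hh0
  have hne : a⁺ ≠ 0 := by
    intro h
    rw [CFC.posPart_eq_zero_iff a haS] at h
    have h2 : E u ≤ algebraMap ℝ A t := by rwa [ha, sub_nonpos] at h
    rw [← CStarAlgebra.norm_le_iff_le_algebraMap _ ht0 (hpos u hu0)] at h2
    linarith
  have key : 0 ≤ a⁺ * a * a⁺ := by
    have e : a⁺ * a * a⁺ = a⁺ * a⁺ * a⁺ := by
      nth_rw 2 [← CFC.posPart_sub_negPart a haS]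
      rw [mul_sub, CFC.posPart_mul_negPart, sub_zero]
    rw [e]
    exact conjugate_nonneg_of_nonneg hh0 hh0
  obtain ⟨k, ⟨hkB, V, hVJ, hV0, hVk, hEV⟩, hk2⟩ := aux_simple B hB hBsimple
    {k | k ∈ B ∧ ∃ V ∈ J, 0 ≤ V ∧ V ≤ k ∧ t • k ≤ E V}
    ⟨B.zero_mem, 0, J.zero_mem, le_rfl, le_rfl, by simp⟩
    (by
      rintro x ⟨hx, V, h1, h2, h3, h4⟩ y ⟨hy, W, g1, g2, g3, g4⟩
      refine ⟨add_mem hx hy, V + W, J.add_mem h1 g1, add_nonneg h2 g2, add_le_add h3 g3, ?_⟩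
      rw [smul_add, map_add]
      exact add_le_add h4 g4)
    (by
      rintro x ⟨hx, V, h1, h2, h3, h4⟩ c hc
      refine ⟨mul_mem (mul_mem (star_mem hc) hx) hc, star c * V * c,
        J.mul_mem_right _ _ (J.mul_mem_left _ _ h1), star_left_conjugate_nonneg h2 c,
        star_left_conjugate_le_conjugate h3 c, ?_⟩
      rw [hright c hc, hleft _ (star_mem hc)]
      have := star_left_conjugate_le_conjugate h4 c
      simpa using this)
    a⁺ hhB hsa hne
    (by
      refine ⟨mul_mem hhB hhB, a⁺ * u * a⁺, J.mul_mem_right _ _ (J.mul_mem_left _ _ huJ),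
        conjugate_nonneg_of_nonneg hu0 hh0, ?_, ?_⟩
      · simpa using conjugate_le_conjugate_of_nonneg hu1 hh0
      · rw [hright _ hhB, hleft _ hhB, ← sub_nonneg]
        refine key.trans (le_of_eq ?_)
        rw [ha, mul_sub, sub_mul, Algebra.algebraMap_eq_smul_one]
        simp)
  have hk1 : (1 : A) ≤ k := le_trans (le_add_of_nonneg_left zero_le_one) hk2
  obtain ⟨r, hrB, hrs, hr⟩ := aux_invsqrt B hB k hkB hk1
  refine ⟨r * V * r, J.mul_mem_right _ _ (J.mul_mem_left _ _ hVJ), ?_, ?_, ?_⟩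
  · exact IsSelfAdjoint.conjugate_nonneg hV0 hrs
  · rw [← hr]
    exact IsSelfAdjoint.conjugate_le_conjugate hVk hrs
  · rw [hright _ hrB, hleft _ hrB]
    have := IsSelfAdjoint.conjugate_le_conjugate hEV hrs
    rw [mul_smul_comm, smul_mul_assoc, hr] at this
    rwa [Algebra.algebraMap_eq_smul_one]

theorem aux_unit (E : A →L[ℂ] A)
    (hpos : ∀ x : A, 0 ≤ x → 0 ≤ E x)
    (l : ℝ) (hl : 0 < l)
    (hPP : ∀ x : A, 0 ≤ x → x ≤ (l : ℂ) • E x)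
    (J : TwoSidedIdeal A) (s ε : ℝ) (hε : 0 ≤ ε)
    (hs : ∀ u ∈ J, 0 ≤ u → u ≤ 1 → E u ≤ algebraMap ℝ A s)
    (v : A) (hvJ : v ∈ J) (hv0 : 0 ≤ v) (hv1 : v ≤ 1)
    (hv : algebraMap ℝ A (s - ε) ≤ E v)
    (y : A) (hyJ : y ∈ J) (hy0 : 0 ≤ y) (hy1 : y ≤ 1) :
    ‖(1 - v) * y * (1 - v)‖ ≤ l * ε := by
  have h1v : 0 ≤ 1 - v := sub_nonneg.2 hv1
  set d := (1 - v) * y * (1 - v) with hd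
  have hd0 : 0 ≤ d := conjugate_nonneg_of_nonneg hy0 h1v
  have hdJ : d ∈ J := J.mul_mem_right _ _ (J.mul_mem_left _ _ hyJ)
  have hd1 : d ≤ (1 - v) * (1 - v) := by
    simpa using conjugate_le_conjugate_of_nonneg hy1 h1v
  have hvv : 0 ≤ v - v * v := by
    have := add_nonneg (conjugate_nonneg_of_nonneg h1v hv0) (conjugate_nonneg_of_nonneg hv0 h1v)
    refine this.trans (le_of_eq ?_)
    noncomm_ring
  have hw1 : v + d ≤ 1 := by
    calc v + d ≤ v + (1 - v) * (1 - v) := by gcongr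
      _ = 1 - (v - v * v) := by noncomm_ring
      _ ≤ 1 := sub_le_self _ hvv
  have h2 := hs (v + d) (J.add_mem hvJ hdJ) (add_nonneg hv0 hd0) hw1
  rw [map_add] at h2
  have h3 : E d ≤ algebraMap ℝ A ε := by
    have : algebraMap ℝ A (s - ε) + E d ≤ algebraMap ℝ A s := (by gcongr : _ ≤ E v + E d).trans h2
    rw [map_sub] at this
    have h4 := sub_nonneg.2 this
    rw [← sub_nonneg]
    refine h4.trans (le_of_eq ?_)
    abel
  have h4 : ‖E d‖ ≤ ε := (CStarAlgebra.norm_le_iff_le_algebraMap _ hε (hpos d hd0)).2 h3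
  calc ‖d‖ ≤ ‖(l : ℂ) • E d‖ := CStarAlgebra.norm_le_norm_of_nonneg_of_le hd0 (hPP d hd0)
    _ = l * ‖E d‖ := by rw [norm_smul]; simp [abs_of_pos hl]
    _ ≤ l * ε := by gcongr

theorem aux_main_s9
    (B : StarSubalgebra ℂ A) (hB : IsClosed (B : Set A))
    (hBsimple : ∀ I : TwoSidedIdeal B, IsClosed (I : Set B) → I = ⊥ ∨ I = ⊤)
    (E : A →L[ℂ] A)
    (hrange : ∀ x : A, E x ∈ B)
    (hleft : ∀ b ∈ B, ∀ x : A, E (b * x) = b * E x)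
    (hright : ∀ b ∈ B, ∀ x : A, E (x * b) = E x * b)
    (hpos : ∀ x : A, 0 ≤ x → 0 ≤ E x)
    (l : ℝ) (hl : 0 < l)
    (hPP : ∀ x : A, 0 ≤ x → x ≤ (l : ℂ) • E x)
    (J : TwoSidedIdeal A) (hJ : IsClosed (J : Set A)) :
    ∃ z : A, z ∈ Set.center A ∧ IsIdempotentElem z ∧ star z = z ∧
      (J : Set A) = {a : A | a * z = a} := by
  let N : Set ℝ := {x | ∃ u ∈ J, 0 ≤ u ∧ u ≤ 1 ∧ x = ‖E u‖}
  have hNne : N.Nonempty := ⟨_, 0, J.zero_mem, le_rfl, zero_le_one, rfl⟩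
  have hNb : BddAbove N := by
    refine ⟨‖E‖, ?_⟩
    rintro x ⟨u, -, h0, h1, rfl⟩
    have : ‖u‖ ≤ 1 := (CStarAlgebra.norm_le_one_iff_of_nonneg u h0).2 h1
    exact (E.le_opNorm u).trans (mul_le_of_le_one_right (norm_nonneg _) this)
  set s := sSup N with hsdef
  have hs : ∀ u ∈ J, 0 ≤ u → u ≤ 1 → E u ≤ algebraMap ℝ A s := by
    intro u hu h0 h1
    have h2 : ‖E u‖ ≤ s := le_csSup hNb ⟨u, hu, h0, h1, rfl⟩
    exact (CStarAlgebra.norm_le_iff_le_algebraMap _ ((norm_nonneg _).trans h2) (hpos u h0)).1 h2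
  have hex : ∀ ε : ℝ, 0 < ε → ∃ v ∈ J, 0 ≤ v ∧ v ≤ 1 ∧ algebraMap ℝ A (s - ε) ≤ E v := by
    intro ε hε
    obtain ⟨x, ⟨u, hu, h0, h1, rfl⟩, h2⟩ := exists_lt_of_lt_csSup hNne (sub_lt_self s hε)
    exact aux_lower B hB hBsimple E hrange hleft hright hpos J u hu h0 h1 _ h2
  -- choose a sequence
  have hex2 : ∀ n : ℕ, ∃ v ∈ J, 0 ≤ v ∧ v ≤ 1 ∧
      (∀ x ∈ J, ‖x‖ ≤ 1 → ‖(1 - v) * x‖ ≤ 1 / ((n : ℝ) + 1) ∧ ‖x * (1 - v)‖ ≤ 1 / ((n : ℝ) + 1)) := by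
    intro n
    obtain ⟨v, hvJ, hv0, hv1, hv⟩ := hex ((1 / ((n : ℝ) + 1)) ^ 2 / l) (by positivity)
    refine ⟨v, hvJ, hv0, hv1, ?_⟩
    have hsv : star (1 - v) = 1 - v := IsSelfAdjoint.of_nonneg (sub_nonneg.2 hv1)
    have key := aux_unit E hpos l hl hPP J s _ (by positivity) hs v hvJ hv0 hv1 hv
    have hle : l * ((1 / ((n : ℝ) + 1)) ^ 2 / l) = (1 / ((n : ℝ) + 1)) ^ 2 := by field_simp
    rw [hle] at key
    intro x hx hx1
    constructor
    · have h1 : x * star x ≤ 1 := by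
        rw [← CStarAlgebra.norm_le_one_iff_of_nonneg _ (mul_star_self_nonneg x),
          CStarRing.norm_self_mul_star]
        nlinarith [norm_nonneg x]
      have := key (x * star x) (J.mul_mem_right _ _ hx) (mul_star_self_nonneg x) h1
      refine (sq_le_sq₀ (norm_nonneg _) (by positivity)).1 (le_trans (le_of_eq ?_) this)
      rw [sq, ← CStarRing.norm_self_mul_star, star_mul, hsv]
      simp only [mul_assoc]
    · have h1 : star x * x ≤ 1 := by
        rw [← CStarAlgebra.norm_le_one_iff_of_nonneg _ (star_mul_self_nonneg x),
          CStarRing.norm_star_mul_self]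
        nlinarith [norm_nonneg x]
      have := key (star x * x) (J.mul_mem_left _ _ hx) (star_mul_self_nonneg x) h1
      refine (sq_le_sq₀ (norm_nonneg _) (by positivity)).1 (le_trans (le_of_eq ?_) this)
      rw [sq, ← CStarRing.norm_star_mul_self, star_mul, hsv]
      simp only [mul_assoc]
  choose v hvJ hv0 hv1 hv using hex2
  have hvn : ∀ n, ‖v n‖ ≤ 1 := fun n =>
    (CStarAlgebra.norm_le_one_iff_of_nonneg _ (hv0 n)).2 (hv1 n)
  have hlim : Filter.Tendsto (fun n : ℕ => 1 / ((n : ℝ) + 1)) Filter.atTop (nhds 0) :=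
    tendsto_one_div_add_atTop_nhds_zero_nat
  have hcau : CauchySeq v := by
    refine cauchySeq_of_le_tendsto_0 (fun n : ℕ => 1 / ((n : ℝ) + 1) + 1 / ((n : ℝ) + 1)) ?_
      (by simpa using hlim.add hlim)
    intro n m k hn hm
    rw [dist_eq_norm]
    have e : v n - v m = v n * (1 - v m) - (1 - v n) * v m := by noncomm_ring
    rw [e]
    refine (norm_sub_le _ _).trans (add_le_add ?_ ?_)
    · refine ((hv m _ (hvJ n) (hvn n)).2).trans ?_
      gcongr
    · refine ((hv n _ (hvJ m) (hvn m)).1).trans ?_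
      gcongr
  obtain ⟨z, hz⟩ := cauchySeq_tendsto_of_complete hcau
  have hzJ : z ∈ J := hJ.mem_of_tendsto hz (Filter.Eventually.of_forall hvJ)
  have hzs : star z = z := by
    have h1 : Filter.Tendsto (fun n => star (v n)) Filter.atTop (nhds (star z)) := hz.star
    have h2 : (fun n => star (v n)) = v := funext fun n => IsSelfAdjoint.of_nonneg (hv0 n)
    rw [h2] at h1
    exact tendsto_nhds_unique h1 hz
  have hunit1 : ∀ x ∈ J, ‖x‖ ≤ 1 → z * x = x ∧ x * z = x := by
    intro x hx hx1
    constructor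
    · have h1 : Filter.Tendsto (fun n => (1 - v n) * x) Filter.atTop (nhds ((1 - z) * x)) :=
        (tendsto_const_nhds.sub hz).mul_const x
      have h2 := squeeze_zero_norm (fun n => (hv n x hx hx1).1) hlim
      have h3 := tendsto_nhds_unique h1 h2
      rw [sub_mul, one_mul, sub_eq_zero] at h3
      exact h3.symm
    · have h1 : Filter.Tendsto (fun n => x * (1 - v n)) Filter.atTop (nhds (x * (1 - z))) :=
        (tendsto_const_nhds.sub hz).const_mul x
      have h2 := squeeze_zero_norm (fun n => (hv n x hx hx1).2) hlim
      have h3 := tendsto_nhds_unique h1 h2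
      rw [mul_sub, mul_one, sub_eq_zero] at h3
      exact h3.symm
  have hunit : ∀ x ∈ J, z * x = x ∧ x * z = x := by
    intro x hx
    set c : ℂ := ((‖x‖ + 1 : ℝ) : ℂ) with hc
    have hc0 : c ≠ 0 := by
      rw [hc]; exact_mod_cast (by positivity : ‖x‖ + 1 ≠ 0)
    have hcx : c⁻¹ • x ∈ J := by
      have := J.mul_mem_left (algebraMap ℂ A c⁻¹) x hx
      rwa [← Algebra.smul_def] at this
    have hcn : ‖c⁻¹ • x‖ ≤ 1 := by
      have hcc : ‖c‖ = ‖x‖ + 1 := by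
        rw [hc, Complex.norm_real, Real.norm_of_nonneg (by positivity)]
      rw [norm_smul, norm_inv, hcc, inv_mul_le_iff₀ (by positivity)]
      linarith
    obtain ⟨h1, h2⟩ := hunit1 _ hcx hcn
    rw [mul_smul_comm] at h1
    rw [smul_mul_assoc] at h2
    have hi := smul_right_injective A (inv_ne_zero hc0)
    exact ⟨hi h1, hi h2⟩
  refine ⟨z, ?_, (hunit z hzJ).1, hzs, ?_⟩
  · rw [Semigroup.mem_center_iff]
    intro g
    have h1 := (hunit _ (J.mul_mem_left g z hzJ)).1
    have h2 := (hunit _ (J.mul_mem_right z g hzJ)).2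
    rw [← h1, ← mul_assoc, h2]
  · ext a
    constructor
    · intro ha
      exact (hunit a ha).2
    · intro ha
      have : a * z ∈ J := J.mul_mem_left a z hzJ
      rwa [show a * z = a from ha] at this

end aux

/-- Let `A ⊃ B` be an inclusion of unital C*-algebras with a
conditional expectation `E : A → B` satisfying the Pimsner–Popa inequality
`x ≤ l • E x` for all positive `x`.  If `B` is simple, then every closed
two-sided ideal `J` of `A` is generated by a selfadjoint central projection
`z`, i.e. `J = A z`. -/
theorem stmt_9 {A : Type*} [NormedRing A] [StarRing A] [CStarRing A] [NormedAlgebra ℂ A]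
    [StarModule ℂ A] [CompleteSpace A] [PartialOrder A] [StarOrderedRing A]
    (B : StarSubalgebra ℂ A) (hB : IsClosed (B : Set A))
    (hBsimple : ∀ I : TwoSidedIdeal B, IsClosed (I : Set B) → I = ⊥ ∨ I = ⊤)
    (E : A →L[ℂ] A)
    (hrange : ∀ x : A, E x ∈ B)
    (hfix : ∀ b ∈ B, E b = b)
    (hleft : ∀ b ∈ B, ∀ x : A, E (b * x) = b * E x)
    (hright : ∀ b ∈ B, ∀ x : A, E (x * b) = E x * b)
    (hpos : ∀ x : A, 0 ≤ x → 0 ≤ E x)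
    (l : ℝ) (hl : 0 < l)
    (hPP : ∀ x : A, 0 ≤ x → x ≤ (l : ℂ) • E x)
    (J : TwoSidedIdeal A) (hJ : IsClosed (J : Set A)) :
    ∃ z : A, z ∈ Set.center A ∧ IsIdempotentElem z ∧ star z = z ∧
      (J : Set A) = {a : A | a * z = a} := by

  letI : CStarAlgebra A := { }
  exact aux_main_s9 B hB hBsimple E hrange hleft hright hpos l hl hPP J hJ
end

section
/- Let φ : C → ℂ be a state on a unital commutative C*-algebra C satisfying the Pimsner–Popa inequality x ≤ λ φ(x)·1 for all x ∈ C₊ and some λ > 0. Then C is finite dimensional, with dimension at most λ. -/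
open scoped ComplexOrder

theorem aux_card {X : Type*} [TopologicalSpace X] [CompactSpace X] [T2Space X]
    (ψ : C(X, ℂ) →ₗ[ℂ] ℂ) (h1 : ψ 1 = 1) (l : ℝ) (hl : 0 < l)
    (h : ∀ f : C(X, ℂ), 0 ≤ f → ∀ x, f x ≤ (l : ℂ) * ψ f) (S : Finset X) :
    (S.card : ℝ) ≤ l := by
  classical
  rcases S.eq_empty_or_nonempty with rfl | ⟨x0, hx0⟩
  · simpa using hl.le
  obtain ⟨ρ, hρ⟩ := PartitionOfUnity.exists_isSubordinate (isClosed_univ (X := X))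
    (fun x : S => ((S.erase x.1 : Finset X) : Set X)ᶜ)
    (fun x => (S.erase x.1).finite_toSet.isClosed.isOpen_compl)
    (by
      intro y _
      by_cases hy : y ∈ S
      · exact Set.mem_iUnion.2 ⟨⟨y, hy⟩, by simp⟩
      · exact Set.mem_iUnion.2 ⟨⟨x0, hx0⟩, by simp [hy]⟩)
  have hsum : ∀ y, ∑ x : S, ρ x y = 1 := by
    intro y
    rw [← finsum_eq_sum_of_fintype]
    exact ρ.sum_eq_one (Set.mem_univ y)
  have hzero : ∀ x y : S, x ≠ y → ρ x y = 0 := by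
    intro x y hxy
    by_contra hne
    have := hρ x (subset_tsupport _ hne)
    exact this (Finset.mem_coe.2 (Finset.mem_erase.2 ⟨fun h => hxy (Subtype.ext h.symm), y.2⟩))
  have hone : ∀ x : S, ρ x x = 1 := by
    intro x
    rw [← hsum x, Finset.sum_eq_single x]
    · intro b _ hb
      exact hzero b x hb
    · simp
  let g : S → C(X, ℂ) := fun x => ⟨fun y => (ρ x y : ℂ), by fun_prop⟩
  have hg : ∑ x, g x = 1 := by
    ext y
    simp only [ContinuousMap.coe_sum, Finset.sum_apply, ContinuousMap.one_apply]
    change ∑ x : S, ((ρ x y : ℝ) : ℂ) = 1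
    exact_mod_cast hsum y
  have hle : ∀ x, (1 : ℂ) ≤ l * ψ (g x) := by
    intro x
    have := h (g x) (by intro y; change (0 : ℂ) ≤ ((ρ x y : ℝ) : ℂ); exact_mod_cast ρ.nonneg x y) x
    have h2 : g x x = 1 := by simp [g, hone]
    rwa [h2] at this
  have := Finset.sum_le_sum (s := Finset.univ) (fun x (_ : x ∈ Finset.univ) => hle x)
  rw [← Finset.mul_sum, ← map_sum, hg, h1] at this
  simp at this
  exact_mod_cast this


/-- Let `φ` be a state on a unital commutative C*-algebra `C`
satisfying the Pimsner–Popa inequality `x ≤ (l * φ x) • 1` for all positive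
`x` and some `l > 0`.  Then `C` is finite dimensional, of dimension at most
`l`. -/
theorem stmt_11 {C : Type*} [NormedCommRing C] [StarRing C] [CStarRing C]
    [NormedAlgebra ℂ C] [StarModule ℂ C] [CompleteSpace C]
    [PartialOrder C] [StarOrderedRing C]
    (φ : C →L[ℂ] ℂ) (hφ1 : φ 1 = 1)
    (hφpos : ∀ x : C, 0 ≤ x → (0 : ℂ) ≤ φ x)
    (l : ℝ) (hl : 0 < l)
    (hPP : ∀ x : C, 0 ≤ x → x ≤ ((l : ℂ) * φ x) • (1 : C)) :
    FiniteDimensional ℂ C ∧ (Module.finrank ℂ C : ℝ) ≤ l := by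
  letI : CommCStarAlgebra C := { (inferInstance : NormedCommRing C), (inferInstance : StarRing C),
    (inferInstance : CStarRing C), (inferInstance : NormedAlgebra ℂ C),
    (inferInstance : StarModule ℂ C), (inferInstance : CompleteSpace C) with }
  let X := WeakDual.characterSpace ℂ C
  let e : C ≃⋆ₐ[ℂ] C(X, ℂ) := gelfandStarTransform C
  let ψ : C(X, ℂ) →ₗ[ℂ] ℂ := φ.toLinearMap ∘ₗ e.symm.toAlgEquiv.toLinearMap
  have hψ : ∀ f, ψ f = φ (e.symm f) := fun _ => rfl
  have hcard := aux_card ψ (by rw [hψ, map_one, hφ1]) l hl (by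
    intro f hf x
    have h1 : 0 ≤ e.symm f := map_nonneg e.symm hf
    have h2 : e (e.symm f) ≤ e (((l : ℂ) * φ (e.symm f)) • (1 : C)) :=
      OrderHomClass.mono e (hPP _ h1)
    rw [map_smul, map_one, StarAlgEquiv.apply_symm_apply] at h2
    have h3 := h2 x
    simpa [hψ] using h3)
  have hfin : Finite X := by
    by_contra hinf
    rw [not_finite_iff_infinite] at hinf
    obtain ⟨n, hn⟩ := exists_nat_gt l
    obtain ⟨S, hS⟩ := Infinite.exists_subset_card_eq X n
    have := hcard S
    rw [hS] at this
    linarith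
  have := Fintype.ofFinite X
  let L : C ≃ₗ[ℂ] (X → ℂ) := e.toAlgEquiv.toLinearEquiv.trans
    { toFun := fun f => f
      invFun := fun f => ⟨f, continuous_of_discreteTopology⟩
      map_add' := fun _ _ => rfl
      map_smul' := fun _ _ => rfl
      left_inv := fun _ => rfl
      right_inv := fun _ => rfl }
  refine ⟨Module.Finite.equiv L.symm, ?_⟩
  rw [L.finrank_eq, Module.finrank_fintype_fun_eq_card]
  exact hcard Finset.univ
end
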